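/- arXiv:1411.0437 — 3 statements merged into one kernel-verified Lean document; each statement's English description precedes it below -/
import Mathlib

section
/- Let M, N ≥ 1 and let γ be a real symmetric positive definite (2M+2N)×(2M+2N) matrix written in block form [[γ_A, C], [Cᵀ, γ_B]], where γ_A has size 2M×2M. If the complex Hermitian matrix γ + i·(0_{2M} ⊕ Ω_N) is positive semidefinite, then det γ ≥ det γ_A. Equivalently, if det γ < det γ_A then γ + i·(0_{2M} ⊕ Ω_N) is not positive semidefinite (so the Gaussian state with covariance matrix γ is steerable from A to B by Gaussian measurements). -/
open Matrix ComplexOrder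

/-- The `2N × 2N` symplectic form: the direct sum of `N` copies of `[[0,1],[-1,0]]`. -/
def Omega (N : ℕ) : Matrix (Fin (2 * N)) (Fin (2 * N)) ℝ :=
  Matrix.of fun i j =>
    if i.val / 2 = j.val / 2 then
      if i.val % 2 = 0 ∧ j.val % 2 = 1 then 1
      else if i.val % 2 = 1 ∧ j.val % 2 = 0 then -1
      else 0
    else 0

/-- The complex matrix `S + i·Ω` obtained from real matrices `S` and `Ω`. -/
noncomputable def addI {n : Type*} (S Om : Matrix n n ℝ) : Matrix n n ℂ :=
  S.map (fun x => (x : ℂ)) + Complex.I • Om.map (fun x => (x : ℂ))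

namespace Matrix

/-- A Hermitian matrix `H` with `-1 ≤ H ≤ 1` has determinant of norm at most one. -/
theorem norm_det_le_one_of_posSemidef {𝕜 n : Type*} [RCLike 𝕜] [Fintype n] [DecidableEq n]
    {H : Matrix n n 𝕜} (hadd : (1 + H).PosSemidef) (hsub : (1 - H).PosSemidef) :
    ‖H.det‖ ≤ 1 := by
  have hH : H.IsHermitian := by simpa using hadd.isHermitian.sub isHermitian_one
  rw [hH.det_eq_prod_eigenvalues, norm_prod]
  refine Finset.prod_le_one (fun _ _ => norm_nonneg _) fun i _ => ?_
  have hv : (star ⇑(hH.eigenvectorBasis i)) ⬝ᵥ ⇑(hH.eigenvectorBasis i) = (1 : 𝕜) := by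
    rw [dotProduct_comm, ← EuclideanSpace.inner_eq_star_dotProduct]
    simp
  have h₁ := hadd.re_dotProduct_nonneg (hH.eigenvectorBasis i)
  have h₂ := hsub.re_dotProduct_nonneg (hH.eigenvectorBasis i)
  rw [add_mulVec, one_mulVec, dotProduct_add, hv, map_add, RCLike.one_re,
    ← hH.eigenvalues_eq] at h₁
  rw [sub_mulVec, one_mulVec, dotProduct_sub, hv, map_sub, RCLike.one_re,
    ← hH.eigenvalues_eq] at h₂
  rw [RCLike.norm_ofReal, abs_le]
  exact ⟨by linarith, by linarith⟩

open scoped MatrixOrder in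
/-- If `-P ≤ Q ≤ P` with `P` positive definite, then `|det Q| ≤ |det P|`. -/
theorem PosDef.norm_det_le_norm_det {𝕜 n : Type*} [RCLike 𝕜] [Fintype n] [DecidableEq n]
    {P Q : Matrix n n 𝕜} (hP : P.PosDef) (hadd : (P + Q).PosSemidef)
    (hsub : (P - Q).PosSemidef) : ‖Q.det‖ ≤ ‖P.det‖ := by
  obtain ⟨Y, rfl⟩ := CStarAlgebra.nonneg_iff_eq_star_mul_self.mp hP.posSemidef.nonneg
  have hY : IsUnit Y.det := by
    have h := hP.det_pos.ne'
    rw [det_mul] at h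
    exact (right_ne_zero_of_mul h).isUnit
  have hone : (Y⁻¹)ᴴ * (star Y * Y) * Y⁻¹ = 1 := by
    rw [star_eq_conjTranspose, ← Matrix.mul_assoc, ← conjTranspose_mul, mul_nonsing_inv _ hY,
      conjTranspose_one, Matrix.one_mul, mul_nonsing_inv _ hY]
  have h₁ := hadd.conjTranspose_mul_mul_same Y⁻¹
  have h₂ := hsub.conjTranspose_mul_mul_same Y⁻¹
  rw [Matrix.mul_add, Matrix.add_mul, hone] at h₁
  rw [Matrix.mul_sub, Matrix.sub_mul, hone] at h₂
  have hQ : Q = Yᴴ * ((Y⁻¹)ᴴ * Q * Y⁻¹) * Y := by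
    rw [← Matrix.mul_assoc, ← Matrix.mul_assoc, ← conjTranspose_mul, nonsing_inv_mul _ hY,
      conjTranspose_one, Matrix.one_mul, Matrix.mul_assoc, nonsing_inv_mul _ hY, Matrix.mul_one]
  have hle := norm_det_le_one_of_posSemidef h₁ h₂
  calc ‖Q.det‖ = ‖Yᴴ.det‖ * ‖((Y⁻¹)ᴴ * Q * Y⁻¹).det‖ * ‖Y.det‖ := by
        conv_lhs => rw [hQ]
        rw [det_mul, det_mul, norm_mul, norm_mul]
    _ ≤ ‖Yᴴ.det‖ * 1 * ‖Y.det‖ := by gcongr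
    _ = ‖(star Y * Y).det‖ := by
        rw [mul_one, det_mul, norm_mul, star_eq_conjTranspose]

end Matrix

theorem Omega_transpose (N : ℕ) : (Omega N)ᵀ = -Omega N := by
  ext i j
  simp only [Omega, transpose_apply, of_apply, Matrix.neg_apply]
  split_ifs <;> first | omega | simp

theorem Omega_mul_self (N : ℕ) : Omega N * Omega N = -1 := by
  ext i k
  have hp : 4 * (i.val / 2) + 1 - i.val < 2 * N := by omega
  rw [mul_apply, Finset.sum_eq_single ⟨4 * (i.val / 2) + 1 - i.val, hp⟩]
  · simp only [Omega, of_apply, Matrix.neg_apply, Matrix.one_apply, Fin.ext_iff]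
    split_ifs <;> first | omega | norm_num
  · intro j _ hj
    have : Omega N i j = 0 := by
      simp only [Omega, of_apply]
      simp only [ne_eq, Fin.ext_iff] at hj
      split_ifs <;> first | omega | rfl
    rw [this, zero_mul]
  · simp

theorem norm_det_I_smul_Omega (N : ℕ) :
    ‖(Complex.I • (Omega N).map (fun x => (x : ℂ))).det‖ = 1 := by
  have hmap : ((Omega N).map (fun x => (x : ℂ))).det = ((Omega N).det : ℂ) :=
    (Complex.ofRealHom.map_det (Omega N)).symm
  have hsq : (Omega N).det * (Omega N).det = 1 := by
    rw [← det_mul, Omega_mul_self, det_neg]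
    simp
  rw [det_smul, hmap, norm_mul, norm_pow, Complex.norm_I, one_pow, one_mul, Complex.norm_real,
    Real.norm_eq_abs]
  rcases mul_self_eq_one_iff.mp hsq with h | h <;> simp [h]

/-- A real symmetric matrix `S` with `S + i·Ω ≥ 0` satisfies `|det S| ≥ 1`. -/
theorem one_le_abs_det_of_addI_Omega_posSemidef {N : ℕ}
    {S : Matrix (Fin (2 * N)) (Fin (2 * N)) ℝ} (hS : S.IsSymm) (hdet : S.det ≠ 0)
    (h : (addI S (Omega N)).PosSemidef) : 1 ≤ |S.det| := by
  have hmap : (S.map (fun x => (x : ℂ))).det = (S.det : ℂ) :=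
    (Complex.ofRealHom.map_det S).symm
  have hsub : (S.map (fun x => (x : ℂ)) -
      Complex.I • (Omega N).map (fun x => (x : ℂ))).PosSemidef := by
    have ht := h.transpose
    rw [addI, transpose_add, transpose_smul, ← transpose_map, ← transpose_map, hS.eq,
      Omega_transpose] at ht
    convert! ht using 1
    ext i j
    simp [sub_eq_add_neg]
  have hP : (S.map (fun x => (x : ℂ))).PosSemidef := by
    have := (h.add hsub).smul (show (0 : ℝ) ≤ 2⁻¹ by norm_num)
    convert! this using 1
    ext i j
    simp [addI]
    ring
  have hPD := hP.posDef_iff_det_ne_zero.mpr (by rw [hmap]; exact_mod_cast hdet)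
  have hle := hPD.norm_det_le_norm_det h hsub
  rwa [norm_det_I_smul_Omega, hmap, Complex.norm_real, Real.norm_eq_abs] at hle

/-- if an `(M+N)`-mode covariance matrix `γ` (symmetric positive
definite) satisfies the non-steerability condition `γ + i·(0_A ⊕ Ω_B) ≥ 0`,
then `det γ ≥ det γ_A`. -/
theorem det_global_ge_det_local_of_nonsteerable (M N : ℕ) (hM : 1 ≤ M) (hN : 1 ≤ N)
    (γA : Matrix (Fin (2 * M)) (Fin (2 * M)) ℝ)
    (γB : Matrix (Fin (2 * N)) (Fin (2 * N)) ℝ)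
    (C : Matrix (Fin (2 * M)) (Fin (2 * N)) ℝ)
    (hpd : (Matrix.fromBlocks γA C Cᵀ γB).PosDef)
    (hsym : (Matrix.fromBlocks γA C Cᵀ γB).IsSymm)
    (hns : (addI (Matrix.fromBlocks γA C Cᵀ γB)
        (Matrix.fromBlocks 0 0 0 (Omega N))).PosSemidef) :
    γA.det ≤ (Matrix.fromBlocks γA C Cᵀ γB).det := by
  have hA : γA.PosDef := hpd.submatrix Sum.inl_injective
  have hApos := hA.det_pos
  let := hA.isUnit.invertible
  have hSdet := det_fromBlocks₁₁ γA C Cᵀ γB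
  rw [invOf_eq_nonsing_inv] at hSdet
  have hpos := hpd.det_pos
  rw [hSdet] at hpos
  have hSpos : 0 < (γB - Cᵀ * γA⁻¹ * C).det := (mul_pos_iff_of_pos_left hApos).mp hpos
  obtain ⟨hAs, -, -, hBs⟩ := isSymm_fromBlocks_iff.mp hsym
  have hS : (γB - Cᵀ * γA⁻¹ * C).IsSymm := by
    rw [IsSymm, transpose_sub, transpose_mul, transpose_mul, transpose_transpose,
      transpose_nonsing_inv, hAs.eq, hBs.eq, Matrix.mul_assoc]
  have hblocks : addI (fromBlocks γA C Cᵀ γB) (fromBlocks 0 0 0 (Omega N)) =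
      fromBlocks (γA.map (fun x => (x : ℂ))) (C.map (fun x => (x : ℂ)))
        (C.map (fun x => (x : ℂ)))ᴴ (addI γB (Omega N)) := by
    ext (i | i) (j | j) <;> simp [addI]
  rw [hblocks] at hns
  have hAc : (γA.map (fun x => (x : ℂ))).PosDef := by
    have hAc' : (γA.map (fun x => (x : ℂ))).PosSemidef := hns.submatrix Sum.inl
    have hmap : (γA.map (fun x => (x : ℂ))).det = (γA.det : ℂ) :=
      (Complex.ofRealHom.map_det γA).symm
    exact hAc'.posDef_iff_det_ne_zero.mpr (by rw [hmap]; exact_mod_cast hApos.ne')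
  let := hAc.isUnit.invertible
  rw [PosDef.fromBlocks₁₁ _ _ hAc] at hns
  have hinv : (γA.map (fun x => (x : ℂ)))⁻¹ = γA⁻¹.map (fun x => (x : ℂ)) := by
    refine inv_eq_right_inv ?_
    calc _ = (γA * γA⁻¹).map (fun x => (x : ℂ)) := (Matrix.map_mul (f := Complex.ofRealHom)).symm
      _ = 1 := by
        rw [mul_nonsing_inv γA hApos.ne'.isUnit]
        exact Matrix.map_one _ Complex.ofReal_zero Complex.ofReal_one
  have hschur : addI γB (Omega N) - (C.map (fun x => (x : ℂ)))ᴴ *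
      (γA.map (fun x => (x : ℂ)))⁻¹ * C.map (fun x => (x : ℂ)) =
      addI (γB - Cᵀ * γA⁻¹ * C) (Omega N) := by
    rw [hinv]
    ext i j
    simp [addI, mul_apply]
    ring
  rw [hschur] at hns
  have hone := one_le_abs_det_of_addI_Omega_posSemidef hS hSpos.ne' hns
  rw [abs_of_pos hSpos] at hone
  rw [hSdet]
  exact le_mul_of_one_le_right hApos.le hone
end

section
/- Let M ≥ 1 and let γ be a real symmetric positive definite (2M+2)×(2M+2) matrix written in block form [[γ_A, C], [Cᵀ, γ_B]], where γ_A has size 2M×2M and γ_B has size 2×2. Then the complex Hermitian matrix γ + i·(0_{2M} ⊕ Ω_1) is positive semidefinite if and only if det γ ≥ det γ_A. That is, for steering of a single mode B by an M-mode party A, the determinant condition det γ < det γ_A is necessary and sufficient for steerability from A to B by Gaussian measurements. -/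
open Matrix ComplexOrder

/-- The single-mode symplectic form `Ω_1 = [[0,1],[-1,0]]`. -/
def Om1 : Matrix (Fin 2) (Fin 2) ℝ := !![0, 1; -1, 0]

/-- The entrywise complexification of a real positive definite matrix is positive definite. -/
theorem Matrix.PosDef.map_ofReal {n : Type*} [Fintype n] [DecidableEq n] {A : Matrix n n ℝ}
    (hA : A.PosDef) : (A.map Complex.ofReal).PosDef := by
  have hunit : IsUnit (A.map Complex.ofReal) := hA.isUnit.map Complex.ofRealHom.mapMatrix
  obtain ⟨B, rfl⟩ : ∃ B : Matrix n n ℝ, A = Bᴴ * B := by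
    open scoped MatrixOrder in
    exact CStarAlgebra.nonneg_iff_eq_star_mul_self.mp hA.posSemidef.nonneg
  have hmap : (Bᴴ * B).map Complex.ofReal =
      (B.map Complex.ofReal)ᴴ * B.map Complex.ofReal := by
    ext i j
    simp [Matrix.mul_apply]
  rw [hmap] at hunit ⊢
  exact (Matrix.posSemidef_conjTranspose_mul_self _).posDef_iff_isUnit.mpr hunit

/-- For a real positive semidefinite `2 × 2` matrix `S`, the uncertainty relation
`S + i·Ω₁ ≥ 0` is equivalent to `1 ≤ det S`. -/
theorem posSemidef_addI_Om1_iff {S : Matrix (Fin 2) (Fin 2) ℝ} (hS : S.PosSemidef) :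
    (addI S Om1).PosSemidef ↔ 1 ≤ S.det := by
  have hsymm : S 1 0 = S 0 1 := by simpa using hS.isHermitian.apply 0 1
  have hdet : (addI S Om1).det = ((S.det - 1 : ℝ) : ℂ) := by
    simp only [Matrix.det_fin_two, addI, Om1, Matrix.add_apply, Matrix.smul_apply,
      Matrix.map_apply, Matrix.of_apply, Matrix.cons_val', Matrix.cons_val_zero,
      Matrix.cons_val_one, hsymm, smul_eq_mul]
    push_cast
    linear_combination Complex.I_sq
  constructor
  · intro h
    have := h.det_nonneg
    rw [hdet, Complex.zero_le_real] at this
    linarith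
  · intro h
    have h00 : 0 ≤ S 0 0 := hS.diag_nonneg
    have hSdet := Matrix.det_fin_two S
    have ha : 0 < S 0 0 := by
      refine h00.lt_of_ne fun h0 => ?_
      rw [hSdet, hsymm, ← h0] at h
      nlinarith [sq_nonneg (S 0 1)]
    have haC : (S 0 0 : ℂ) ≠ 0 := by exact_mod_cast ha.ne'
    let L : Matrix (Fin 2) (Fin 2) ℂ := !![1, 0; (S 0 1 - Complex.I) / S 0 0, 1]
    let D : Matrix (Fin 2) (Fin 2) ℂ :=
      Matrix.diagonal ![(S 0 0 : ℂ), (((S.det - 1) / S 0 0 : ℝ) : ℂ)]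
    have hD : D.PosSemidef := by
      refine Matrix.PosSemidef.diagonal fun i => ?_
      fin_cases i
      · exact Complex.zero_le_real.mpr h00
      · exact Complex.zero_le_real.mpr (div_nonneg (sub_nonneg.mpr h) h00)
    have hLDL : addI S Om1 = L * D * Lᴴ := by
      rw [← Matrix.ext_iff]
      simp only [Fin.forall_fin_two]
      refine ⟨⟨?_, ?_⟩, ?_, ?_⟩ <;>
        simp only [L, D, addI, Om1, Matrix.mul_apply, Fin.sum_univ_two, Matrix.diagonal_apply,
          Matrix.conjTranspose_apply, hSdet, hsymm] <;>
        simp [hsymm] <;>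
        field_simp
      · ring
      · linear_combination Complex.I_sq
    rw [hLDL]
    exact hD.mul_mul_conjTranspose_same L

/-- for an `(M+1)`-mode covariance matrix (symmetric positive
definite) whose steered party `B` is a single mode, the non-steerability
condition `γ + i·(0_A ⊕ Ω_1) ≥ 0` holds if and only if `det γ ≥ det γ_A`. -/
theorem nonsteerable_iff_det_of_single_mode (M : ℕ) (hM : 1 ≤ M)
    (γA : Matrix (Fin (2 * M)) (Fin (2 * M)) ℝ)
    (γB : Matrix (Fin 2) (Fin 2) ℝ)
    (C : Matrix (Fin (2 * M)) (Fin 2) ℝ)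
    (hpd : (Matrix.fromBlocks γA C Cᵀ γB).PosDef)
    (hsym : (Matrix.fromBlocks γA C Cᵀ γB).IsSymm) :
    (addI (Matrix.fromBlocks γA C Cᵀ γB)
        (Matrix.fromBlocks 0 0 0 Om1)).PosSemidef ↔
      γA.det ≤ (Matrix.fromBlocks γA C Cᵀ γB).det := by
  have hA : γA.PosDef := hpd.submatrix Sum.inl_injective
  have hAC := hA.map_ofReal
  let : Invertible γA := hA.isUnit.invertible
  let : Invertible (γA.map Complex.ofReal) := hAC.isUnit.invertible
  have hS : (γB - Cᵀ * γA⁻¹ * C).PosSemidef := by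
    have := (Matrix.PosDef.fromBlocks₁₁ C γB hA).mp
      (by simpa [Matrix.conjTranspose_eq_transpose_of_trivial] using hpd.posSemidef)
    rwa [Matrix.conjTranspose_eq_transpose_of_trivial] at this
  have hblocks : addI (Matrix.fromBlocks γA C Cᵀ γB) (Matrix.fromBlocks 0 0 0 Om1) =
      Matrix.fromBlocks (γA.map Complex.ofReal) (C.map Complex.ofReal)
        (C.map Complex.ofReal)ᴴ (addI γB Om1) := by
    ext (i | i) (j | j) <;> simp [addI]
  have hinv : (γA.map Complex.ofReal)⁻¹ = γA⁻¹.map Complex.ofReal := by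
    refine Matrix.inv_eq_right_inv ?_
    have := congrArg Complex.ofRealHom.mapMatrix (Matrix.mul_inv_of_invertible γA)
    rw [map_mul, map_one] at this
    exact this
  have hschur : addI γB Om1 - (C.map Complex.ofReal)ᴴ * (γA.map Complex.ofReal)⁻¹ *
      C.map Complex.ofReal = addI (γB - Cᵀ * γA⁻¹ * C) Om1 := by
    rw [hinv]
    ext i j
    simp only [addI, Matrix.sub_apply, Matrix.add_apply, Matrix.map_apply, Matrix.mul_apply,
      Matrix.conjTranspose_apply, Matrix.transpose_apply, Complex.star_def, Complex.conj_ofReal]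
    push_cast
    ring
  rw [hblocks, Matrix.PosDef.fromBlocks₁₁ _ _ hAC, hschur, posSemidef_addI_Om1_iff hS,
    Matrix.det_fromBlocks₁₁, Matrix.invOf_eq_nonsing_inv, le_mul_iff_one_le_right hA.det_pos]
end

section
/- Let r > 0 and 0 ≤ η ≤ 1, and let γ' be the 4×4 real matrix with rows (cosh 2r, 0, √η·sinh 2r, 0), (0, cosh 2r, 0, −√η·sinh 2r), (√η·sinh 2r, 0, η·cosh 2r + 1 − η, 0), (0, −√η·sinh 2r, 0, η·cosh 2r + 1 − η), the covariance matrix of a two-mode squeezed vacuum state whose mode B passed through a lossy channel of transmissivity η. Then det γ' < det γ_B (i.e., B can steer A by Gaussian measurements) if and only if η > 1/2, where γ_B = (η·cosh 2r + 1 − η)·I_2 is the lower-right 2×2 block. -/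
open Matrix Real

/-- Covariance matrix of a two-mode squeezed vacuum state (squeezing `r`)
whose mode `B` passed through a lossy channel of transmissivity `η`. -/
noncomputable def γloss (r η : ℝ) : Matrix (Fin 4) (Fin 4) ℝ :=
  !![Real.cosh (2 * r), 0, Real.sqrt η * Real.sinh (2 * r), 0;
     0, Real.cosh (2 * r), 0, -(Real.sqrt η * Real.sinh (2 * r));
     Real.sqrt η * Real.sinh (2 * r), 0, η * Real.cosh (2 * r) + 1 - η, 0;
     0, -(Real.sqrt η * Real.sinh (2 * r)), 0, η * Real.cosh (2 * r) + 1 - η]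

/-- The determinant of the lossy two-mode squeezed state, in terms of the symplectic
eigenvalue `(1 - η) cosh (2r) + η`. -/
theorem det_γloss (r η : ℝ) (hη : 0 ≤ η) :
    (γloss r η).det = ((1 - η) * Real.cosh (2 * r) + η) ^ 2 := by
  have hdet : (γloss r η).det = (Real.cosh (2 * r) * (η * Real.cosh (2 * r) + 1 - η) -
      Real.sqrt η ^ 2 * Real.sinh (2 * r) ^ 2) ^ 2 := by
    simp [γloss, Matrix.det_succ_row_zero, Fin.sum_univ_succ, Fin.succAbove]
    ring
  rw [hdet, Real.sq_sqrt hη, Real.sinh_sq]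
  ring

/-- for the lossy-channel state, `B` can steer `A` by Gaussian
measurements (`det γ' < det γ_B` with `γ_B = (η·cosh(2r)+1−η)·I₂`)
iff `η > 1/2`. -/
theorem lossy_steer_B_to_A_iff (r η : ℝ) (hr : 0 < r) (hη0 : 0 ≤ η) (hη1 : η ≤ 1) :
    (γloss r η).det <
      ((η * Real.cosh (2 * r) + 1 - η) • (1 : Matrix (Fin 2) (Fin 2) ℝ)).det ↔
      1 / 2 < η := by
  have hc : 1 < Real.cosh (2 * r) := Real.one_lt_cosh.2 (by positivity)
  have ha : 0 ≤ (1 - η) * Real.cosh (2 * r) + η := by nlinarith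
  have hb : 0 ≤ η * Real.cosh (2 * r) + 1 - η := by nlinarith
  rw [det_γloss r η hη0, Matrix.det_smul, Matrix.det_one, mul_one, Fintype.card_fin,
    sq_lt_sq₀ ha hb]
  constructor <;> intro h <;> nlinarith
end
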